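/- arXiv:math/0212155 — 4 statements merged into one kernel-verified Lean document; each statement's English description precedes it below -/
import Mathlib

section
/- For complex numbers τ, σ with Im τ > 0 and Im σ > 0, and any z ∈ ℂ such that e^{2πi(jτ+kσ+z)} ≠ 1 for all nonnegative integers j, k, the double infinite product ∏_{j,k=0}^∞ (1 − e^{2πi((j+1)τ+(k+1)σ−z)})/(1 − e^{2πi(jτ+kσ+z)}) defining the elliptic gamma function Γ(z,τ,σ) converges (the family of factors indexed by (j,k) ∈ ℕ×ℕ is multipliable). -/
open Complex Real Filter

/-- The q-Pochhammer infinite product `(x; q) = ∏_{j=0}^∞ (1 - x q^j)`. -/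
noncomputable def qPoch (x q : ℂ) : ℂ := ∏' j : ℕ, (1 - x * q ^ j)

/-- The Jacobi theta function `θ₀(z,τ) = (x;q)(q/x;q)` with `x = e^{2πiz}`, `q = e^{2πiτ}`. -/
noncomputable def theta₀ (z τ : ℂ) : ℂ :=
  qPoch (Complex.exp (2 * Real.pi * Complex.I * z)) (Complex.exp (2 * Real.pi * Complex.I * τ)) *
  qPoch (Complex.exp (2 * Real.pi * Complex.I * τ) / Complex.exp (2 * Real.pi * Complex.I * z))
    (Complex.exp (2 * Real.pi * Complex.I * τ))

/-- The elliptic gamma function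
`Γ(z,τ,σ) = ∏_{j,k≥0} (1 - e^{2πi((j+1)τ+(k+1)σ-z)}) / (1 - e^{2πi(jτ+kσ+z)})`. -/
noncomputable def ellipticGamma (z τ σ : ℂ) : ℂ :=
  ∏' p : ℕ × ℕ,
    (1 - Complex.exp (2 * Real.pi * Complex.I *
        (((p.1 : ℂ) + 1) * τ + ((p.2 : ℂ) + 1) * σ - z))) /
    (1 - Complex.exp (2 * Real.pi * Complex.I * ((p.1 : ℂ) * τ + (p.2 : ℂ) * σ + z)))

/-- All denominator factors of the product defining `Γ(z,τ,σ)` are nonzero. -/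
def EllipticGammaDefined (z τ σ : ℂ) : Prop :=
  ∀ j k : ℕ, Complex.exp (2 * Real.pi * Complex.I * ((j : ℂ) * τ + (k : ℂ) * σ + z)) ≠ 1

/-- The normalized elliptic gamma function
`Γ̄(z,τ,σ) = ((q;q)/(r;r)) θ₀(τ,σ)^{1-z} Γ(zτ,τ,σ)` with `q = e^{2πiτ}`, `r = e^{2πiσ}`;
the power is the principal-branch complex power. -/
noncomputable def ellipticGammaBar (z τ σ : ℂ) : ℂ :=
  (qPoch (Complex.exp (2 * Real.pi * Complex.I * τ)) (Complex.exp (2 * Real.pi * Complex.I * τ)) /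
   qPoch (Complex.exp (2 * Real.pi * Complex.I * σ)) (Complex.exp (2 * Real.pi * Complex.I * σ))) *
  theta₀ τ σ ^ (1 - z) * ellipticGamma (z * τ) τ σ

/-- Jackson's q-gamma function `Γ_q(z) = (1-q)^{1-z} (q;q)/(q^z;q)`, `q = e^{2πiτ}`,
with principal-branch powers. -/
noncomputable def qGammaTrig (z τ : ℂ) : ℂ :=
  (1 - Complex.exp (2 * Real.pi * Complex.I * τ)) ^ (1 - z) *
    qPoch (Complex.exp (2 * Real.pi * Complex.I * τ)) (Complex.exp (2 * Real.pi * Complex.I * τ)) /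
    qPoch (Complex.exp (2 * Real.pi * Complex.I * τ * z)) (Complex.exp (2 * Real.pi * Complex.I * τ))

lemma norm_exp_two_pi_I_mul_lt_one {τ : ℂ} (hτ : 0 < τ.im) :
    ‖Complex.exp (2 * Real.pi * Complex.I * τ)‖ < 1 := by
  rw [Complex.norm_exp, Real.exp_lt_one_iff]
  simpa using by positivity

lemma summable_mul_pow_mul_pow {q r : ℂ} (hq : ‖q‖ < 1) (hr : ‖r‖ < 1) (x : ℂ) :
    Summable fun p : ℕ × ℕ => ‖x * (q ^ p.1 * r ^ p.2)‖ := by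
  simp only [norm_mul x]
  exact ((summable_norm_geometric_of_norm_lt_one hq).mul_norm
    (summable_norm_geometric_of_norm_lt_one hr)).mul_left _

lemma multipliable_one_sub_mul_pow_mul_pow_div {q r x y : ℂ} (hq : ‖q‖ < 1) (hr : ‖r‖ < 1)
    (hy : ∀ j k : ℕ, y * (q ^ j * r ^ k) ≠ 1) :
    Multipliable fun p : ℕ × ℕ =>
      (1 - x * (q ^ p.1 * r ^ p.2)) / (1 - y * (q ^ p.1 * r ^ p.2)) := by
  have hsum (w : ℂ) : Summable fun p : ℕ × ℕ => ‖-(w * (q ^ p.1 * r ^ p.2))‖ := by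
    simpa only [norm_neg] using summable_mul_pow_mul_pow hq hr w
  simp only [sub_eq_add_neg (1 : ℂ)]
  refine (multipliable_one_add_of_summable (hsum x)).div₀
    (multipliable_one_add_of_summable (hsum y))
    (tprod_one_add_ne_zero_of_summable (fun p h => hy p.1 p.2 ?_) (hsum y))
  linear_combination -h

lemma exp_two_pi_I_mul_nat_mul_add (τ σ z : ℂ) (j k : ℕ) :
    Complex.exp (2 * Real.pi * Complex.I * ((j : ℂ) * τ + (k : ℂ) * σ + z)) =
      Complex.exp (2 * Real.pi * Complex.I * z) *
        (Complex.exp (2 * Real.pi * Complex.I * τ) ^ j *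
          Complex.exp (2 * Real.pi * Complex.I * σ) ^ k) := by
  simp only [← Complex.exp_nat_mul, ← Complex.exp_add]
  congr 1
  ring

/-- convergence (multipliability) of the double product defining
the elliptic gamma function. -/
theorem ellipticGamma_multipliable (z τ σ : ℂ) (hτ : 0 < τ.im) (hσ : 0 < σ.im)
    (hz : EllipticGammaDefined z τ σ) :
    Multipliable (fun p : ℕ × ℕ =>
      (1 - Complex.exp (2 * Real.pi * Complex.I *
          (((p.1 : ℂ) + 1) * τ + ((p.2 : ℂ) + 1) * σ - z))) /
      (1 - Complex.exp (2 * Real.pi * Complex.I * ((p.1 : ℂ) * τ + (p.2 : ℂ) * σ + z)))) := by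
  have hnumer (j k : ℕ) : ((j : ℂ) + 1) * τ + ((k : ℂ) + 1) * σ - z =
      (j : ℂ) * τ + (k : ℂ) * σ + (τ + σ - z) := by ring
  unfold EllipticGammaDefined at hz
  simp only [hnumer, exp_two_pi_I_mul_nat_mul_add] at hz ⊢
  exact multipliable_one_sub_mul_pow_mul_pow_div (norm_exp_two_pi_I_mul_lt_one hτ)
    (norm_exp_two_pi_I_mul_lt_one hσ) hz
end

section
/- For any natural number n ≥ 1 and complex numbers τ, σ with Im τ > 0 and Im σ > 0, setting q = e^{2πiτ}, one has Γ(τ, nτ, σ) · Γ(2τ, nτ, σ) · … · Γ((n−1)τ, nτ, σ) = 1 / ((q; qⁿ)(q²; qⁿ) ⋯ (q^{n−1}; qⁿ)), i.e. ∏_{k=1}^{n−1} Γ(kτ, nτ, σ) = ∏_{k=1}^{n−1} (q^k; qⁿ)^{−1}. -/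
open Complex Real Filter

/-- The double `q`-Pochhammer product `∏_{j,k≥0} (1 - a q^j r^k)`. -/
noncomputable def qPochDouble (a q r : ℂ) : ℂ := ∏' p : ℕ × ℕ, (1 - a * q ^ p.1 * r ^ p.2)

section

variable {a q r : ℂ}

lemma summable_norm_qPoch (hq : ‖q‖ < 1) : Summable fun j : ℕ ↦ ‖-(a * q ^ j)‖ := by
  simpa using (summable_geometric_of_lt_one (norm_nonneg q) hq).mul_left ‖a‖

lemma summable_norm_qPochDouble (hq : ‖q‖ < 1) (hr : ‖r‖ < 1) :
    Summable fun p : ℕ × ℕ ↦ ‖-(a * q ^ p.1 * r ^ p.2)‖ := by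
  simpa [mul_assoc] using ((summable_geometric_of_lt_one (norm_nonneg q) hq).mul_of_nonneg
    (summable_geometric_of_lt_one (norm_nonneg r) hr) (fun _ ↦ by positivity)
    (fun _ ↦ by positivity)).mul_left ‖a‖

lemma multipliable_qPoch (hq : ‖q‖ < 1) : Multipliable fun j : ℕ ↦ 1 - a * q ^ j := by
  simpa only [sub_eq_add_neg] using multipliable_one_add_of_summable (summable_norm_qPoch hq)

lemma multipliable_qPochDouble (hq : ‖q‖ < 1) (hr : ‖r‖ < 1) :
    Multipliable fun p : ℕ × ℕ ↦ 1 - a * q ^ p.1 * r ^ p.2 := by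
  simpa only [sub_eq_add_neg] using
    multipliable_one_add_of_summable (summable_norm_qPochDouble hq hr)

lemma qPochDouble_ne_zero (ha : ‖a‖ < 1) (hq : ‖q‖ < 1) (hr : ‖r‖ < 1) :
    qPochDouble a q r ≠ 0 := by
  simp only [qPochDouble, sub_eq_add_neg]
  refine tprod_one_add_ne_zero_of_summable (fun p h ↦ ?_) (summable_norm_qPochDouble hq hr)
  have h1 : ‖a * q ^ p.1 * r ^ p.2‖ = 1 := by
    rw [← sub_eq_add_neg, sub_eq_zero] at h
    rw [← h, norm_one]
  have h2 : ‖a * q ^ p.1 * r ^ p.2‖ ≤ ‖a‖ * 1 * 1 := by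
    rw [norm_mul, norm_mul, norm_pow, norm_pow]
    gcongr
    · exact pow_le_one₀ (norm_nonneg _) hq.le
    · exact pow_le_one₀ (norm_nonneg _) hr.le
  linarith

lemma hasProd_qPoch_qPochDouble (hq : ‖q‖ < 1) (hr : ‖r‖ < 1) :
    HasProd (fun k : ℕ ↦ qPoch (a * r ^ k) q) (qPochDouble a q r) := by
  refine ((Equiv.prodComm ℕ ℕ).hasProd_iff.2
    (multipliable_qPochDouble (a := a) hq hr).hasProd).prod_fiberwise fun k ↦ ?_
  convert (multipliable_qPoch (a := a * r ^ k) hq).hasProd using 1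
  · funext j
    simp only [Function.comp_apply, Equiv.prodComm_apply, Prod.fst_swap, Prod.snd_swap]
    ring
  · rfl

lemma qPochDouble_eq_qPoch_mul (hq : ‖q‖ < 1) (hr : ‖r‖ < 1) :
    qPochDouble a q r = qPoch a q * qPochDouble (a * r) q r := by
  have h : (fun k : ℕ ↦ qPoch (a * r ^ (k + 1)) q) = fun k ↦ qPoch (a * r * r ^ k) q := by
    funext k
    rw [pow_succ', mul_assoc]
  have hs := hasProd_qPoch_qPochDouble (a := a * r) hq hr
  rw [← h] at hs
  rw [← (hasProd_qPoch_qPochDouble hq hr).tprod_eq,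
    tprod_eq_zero_mul' (f := fun k : ℕ ↦ qPoch (a * r ^ k) q) hs.multipliable, hs.tprod_eq,
    pow_zero, mul_one]

end

lemma ellipticGamma_eq_div {z τ σ : ℂ} (hz : 0 < z.im) (hτ : 0 < τ.im) (hσ : 0 < σ.im) :
    ellipticGamma z τ σ =
      qPochDouble (Complex.exp (2 * Real.pi * Complex.I * (τ - z)) *
          Complex.exp (2 * Real.pi * Complex.I * σ))
        (Complex.exp (2 * Real.pi * Complex.I * τ)) (Complex.exp (2 * Real.pi * Complex.I * σ)) /
      qPochDouble (Complex.exp (2 * Real.pi * Complex.I * z))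
        (Complex.exp (2 * Real.pi * Complex.I * τ)) (Complex.exp (2 * Real.pi * Complex.I * σ)) := by
  have hq := norm_exp_two_pi_I_mul_lt_one hτ
  have hr := norm_exp_two_pi_I_mul_lt_one hσ
  have hne := qPochDouble_ne_zero (norm_exp_two_pi_I_mul_lt_one hz) hq hr
  unfold qPochDouble at hne ⊢
  rw [← (multipliable_qPochDouble hq hr).tprod_div₀ (multipliable_qPochDouble hq hr) hne]
  refine tprod_congr fun p ↦ ?_
  simp only [← Complex.exp_nat_mul, ← Complex.exp_add]
  congr 3 <;> ring_nf

/-- `∏_{k=1}^{n-1} Γ(kτ, nτ, σ) = ∏_{k=1}^{n-1} (q^k; q^n)⁻¹`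
with `q = e^{2πiτ}`. -/
theorem ellipticGamma_theta_product (n : ℕ) (hn : 1 ≤ n) (τ σ : ℂ)
    (hτ : 0 < τ.im) (hσ : 0 < σ.im) :
    ∏ k ∈ Finset.Icc 1 (n - 1), ellipticGamma ((k : ℂ) * τ) ((n : ℂ) * τ) σ =
      ∏ k ∈ Finset.Icc 1 (n - 1),
        (qPoch (Complex.exp (2 * Real.pi * Complex.I * τ) ^ k)
          (Complex.exp (2 * Real.pi * Complex.I * τ) ^ n))⁻¹ := by
  set q := Complex.exp (2 * Real.pi * Complex.I * τ) with hqdef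
  set r := Complex.exp (2 * Real.pi * Complex.I * σ) with hrdef
  have hr : ‖r‖ < 1 := norm_exp_two_pi_I_mul_lt_one hσ
  have hpow (k : ℕ) : Complex.exp (2 * Real.pi * Complex.I * (k * τ)) = q ^ k := by
    rw [hqdef, ← Complex.exp_nat_mul]
    ring_nf
  have him {k : ℕ} (hk : 1 ≤ k) : 0 < ((k : ℂ) * τ).im := by
    have : (0 : ℝ) < k := by exact_mod_cast hk
    simpa using mul_pos this hτ
  have hqk {k : ℕ} (hk : 1 ≤ k) : ‖q ^ k‖ < 1 := by
    rw [← hpow]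
    exact norm_exp_two_pi_I_mul_lt_one (him hk)
  have hne {k : ℕ} (hk : 1 ≤ k) : qPochDouble (q ^ k * r) (q ^ n) r ≠ 0 := by
    refine qPochDouble_ne_zero ?_ (hqk hn) hr
    rw [norm_mul]
    exact mul_lt_one_of_nonneg_of_lt_one_left (norm_nonneg _) (hqk hk) hr.le
  have hΓ : ∀ k ∈ Finset.Icc 1 (n - 1), ellipticGamma ((k : ℂ) * τ) ((n : ℂ) * τ) σ =
      (qPoch (q ^ k) (q ^ n))⁻¹ *
        (qPochDouble (q ^ (n - k) * r) (q ^ n) r / qPochDouble (q ^ k * r) (q ^ n) r) := by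
    intro k hk
    rw [Finset.mem_Icc] at hk
    rw [ellipticGamma_eq_div (him hk.1) (him hn) hσ, ← sub_mul, ← Nat.cast_sub (by omega), hpow,
      hpow, hpow, ← hrdef, qPochDouble_eq_qPoch_mul (a := q ^ k) (hqk hn) hr]
    rw [mul_comm (qPoch _ _), ← div_div, div_eq_inv_mul _ (qPoch _ _)]
  have hreflect : ∏ k ∈ Finset.Icc 1 (n - 1), qPochDouble (q ^ (n - k) * r) (q ^ n) r =
      ∏ k ∈ Finset.Icc 1 (n - 1), qPochDouble (q ^ k * r) (q ^ n) r := by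
    refine Finset.prod_nbij' (n - ·) (n - ·) ?_ ?_ ?_ ?_ fun _ _ ↦ rfl <;>
      intro k hk <;> simp only [Finset.mem_Icc] at hk ⊢ <;> omega
  rw [Finset.prod_congr rfl hΓ, Finset.prod_mul_distrib, Finset.prod_div_distrib, hreflect,
    div_self, mul_one]
  exact Finset.prod_ne_zero_iff.2 fun k hk ↦ hne (Finset.mem_Icc.1 hk).1
end

section
/- For fixed complex numbers z and τ with Im τ > 0 (and z avoiding the poles of the functions involved), the normalized elliptic gamma function degenerates to Jackson's q-gamma function in the trigonometric limit: Γ̄(z, τ, i t) → Γ_trig(z, τ) as the real parameter t → +∞, where Γ_trig(z,τ) = (1−q)^{1−z} (q;q)/(q^z;q) with q = e^{2πiτ}. -/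
open Complex Real Filter

open scoped Topology

section TrigonometricLimit

variable {ι : Type*} {l : Filter ι} {r y : ι → ℂ}

/-- As the nome tends to zero, `(y; r)` reduces to its first factor. -/
lemma qPoch_tendsto_one_sub {a : ℂ} (hr : Tendsto r l (𝓝 0)) (hy : Tendsto y l (𝓝 a)) :
    Tendsto (fun t => qPoch (y t) (r t)) l (𝓝 (1 - a)) := by
  have hlim : ∏' j : ℕ, (1 + -(a * 0 ^ j)) = 1 - a := by
    rw [tprod_eq_mulSingle 0 (fun j hj => by simp [hj])]
    simp [sub_eq_add_neg]
  have hbound : Summable fun j : ℕ => (‖a‖ + 1) * (1 / 2 : ℝ) ^ j :=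
    summable_geometric_two.mul_left _
  simp only [qPoch, sub_eq_add_neg (1 : ℂ)]
  rw [← sub_eq_add_neg, ← hlim]
  refine tendsto_tprod_one_add_of_dominated_convergence hbound
    (fun j => (hy.mul (hr.pow j)).neg) ?_
  have hr' : ∀ᶠ t in l, ‖r t‖ < 1 / 2 := hr.norm.eventually_lt_const (by simp)
  have hy' : ∀ᶠ t in l, ‖y t‖ < ‖a‖ + 1 := hy.norm.eventually_lt_const (by simp)
  filter_upwards [hr', hy'] with t h₁ h₂ j
  rw [norm_neg, norm_mul, norm_pow]
  gcongr

lemma tprod_one_sub_inv_eq_qPoch_inv {q x : ℂ} (hq : ‖q‖ < 1) (hx : ∀ j : ℕ, x * q ^ j ≠ 1) :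
    ∏' j : ℕ, (1 - x * q ^ j)⁻¹ = (qPoch x q)⁻¹ := by
  have hs : Summable fun j : ℕ => ‖-(x * q ^ j)‖ := by
    simpa using (summable_geometric_of_lt_one (norm_nonneg q) hq).mul_left ‖x‖
  have hm := multipliable_one_add_of_summable hs
  have hne : ∏' j : ℕ, (1 + -(x * q ^ j)) ≠ 0 :=
    tprod_one_add_ne_zero_of_summable
      (fun j => by simpa [← sub_eq_add_neg, sub_eq_zero] using (hx j).symm) hs
  simpa only [qPoch, sub_eq_add_neg] using hm.tprod_inv₀ hne

/-- As the second nome tends to zero, only the row `k = 0` of the denominator of the double product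
defining the elliptic gamma function survives. -/
lemma tprod_div_tendsto_qPoch_inv {q x : ℂ} (w : ℂ) (hq : ‖q‖ < 1)
    (hx : ∀ j : ℕ, x * q ^ j ≠ 1) (hr : Tendsto r l (𝓝 0)) :
    Tendsto (fun t => ∏' p : ℕ × ℕ,
      (1 - w * q ^ p.1 * r t ^ (p.2 + 1)) / (1 - x * q ^ p.1 * r t ^ p.2)) l
      (𝓝 (qPoch x q)⁻¹) := by
  let g : ℂ → ℕ × ℕ → ℂ := fun s p =>
    (x * q ^ p.1 * s ^ p.2 - w * q ^ p.1 * s ^ (p.2 + 1)) * (1 - x * q ^ p.1 * s ^ p.2)⁻¹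
  have one_add_g {s : ℂ} {p : ℕ × ℕ} (h : 1 - x * q ^ p.1 * s ^ p.2 ≠ 0) :
      1 + g s p = (1 - w * q ^ p.1 * s ^ (p.2 + 1)) / (1 - x * q ^ p.1 * s ^ p.2) := by
    simp only [g]
    field_simp
    ring
  have hne0 (p : ℕ × ℕ) : 1 - x * q ^ p.1 * 0 ^ p.2 ≠ 0 := by
    rcases Nat.eq_zero_or_pos p.2 with h | h
    · simpa [h, sub_eq_zero] using (hx p.1).symm
    · simp [h.ne']
  have hlim : ∏' p : ℕ × ℕ, (1 + g 0 p) = (qPoch x q)⁻¹ := by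
    rw [← tprod_one_sub_inv_eq_qPoch_inv hq hx]
    have hinj : Function.Injective fun j : ℕ => (j, 0) := fun a b h => (Prod.mk.inj h).1
    rw [← hinj.tprod_eq]
    · refine tprod_congr fun j => ?_
      rw [one_add_g (hne0 _)]
      simp
    · rintro ⟨j, k⟩ hp
      rcases Nat.eq_zero_or_pos k with rfl | h
      · exact ⟨j, rfl⟩
      · exact absurd (by simp [g, h.ne']) hp
  obtain ⟨M, hM⟩ : ∃ M : ℝ, ∀ j : ℕ, ‖(1 - x * q ^ j)⁻¹‖ ≤ M := by
    have h : Tendsto (fun j : ℕ => ‖(1 - x * q ^ j)⁻¹‖) atTop (𝓝 ‖(1 - x * 0 : ℂ)⁻¹‖) :=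
      (((tendsto_pow_atTop_nhds_zero_of_norm_lt_one hq).const_mul x).const_sub 1
        |>.inv₀ (by simp)).norm
    obtain ⟨M, hM⟩ := h.bddAbove_range
    exact ⟨M, fun j => hM ⟨j, rfl⟩⟩
  have hr₁ : ∀ᶠ t in l, ‖r t‖ < 1 / 2 := hr.norm.eventually_lt_const (by simp)
  have hr₂ : ∀ᶠ t in l, ‖x * r t‖ < 1 / 2 :=
    (hr.const_mul x).norm.eventually_lt_const (by simp)
  have hden {s : ℂ} (h₁ : ‖s‖ < 1 / 2) (h₂ : ‖x * s‖ < 1 / 2) (p : ℕ × ℕ) :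
      1 - x * q ^ p.1 * s ^ p.2 ≠ 0 ∧ ‖(1 - x * q ^ p.1 * s ^ p.2)⁻¹‖ ≤ max M 2 := by
    obtain ⟨j, k⟩ := p
    rcases k with _ | k
    · exact ⟨by simpa [sub_eq_zero] using (hx j).symm, by simpa using Or.inl (hM j)⟩
    · have hsmall : ‖x * q ^ j * s ^ (k + 1)‖ ≤ 1 / 2 := by
        calc ‖x * q ^ j * s ^ (k + 1)‖ = ‖x * s‖ * ‖q‖ ^ j * ‖s‖ ^ k := by
              simp only [norm_mul, norm_pow]; ring
          _ ≤ 1 / 2 * 1 * 1 := by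
              gcongr
              · exact pow_le_one₀ (norm_nonneg _) hq.le
              · exact pow_le_one₀ (norm_nonneg _) (by linarith)
          _ = 1 / 2 := by norm_num
      have hlow : 1 / 2 ≤ ‖1 - x * q ^ j * s ^ (k + 1)‖ := by
        have := norm_sub_norm_le (1 : ℂ) (x * q ^ j * s ^ (k + 1))
        rw [norm_one] at this
        linarith
      refine ⟨norm_pos_iff.mp (by linarith), le_max_of_le_right ?_⟩
      rw [norm_inv]
      exact inv_le_of_inv_le₀ (by norm_num) (by simpa using hlow)
  have hsum : Summable fun p : ℕ × ℕ =>
      (‖x‖ + ‖w‖) * max M 2 * (‖q‖ ^ p.1 * (1 / 2 : ℝ) ^ p.2) :=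
    ((summable_geometric_of_lt_one (norm_nonneg q) hq).mul_of_nonneg summable_geometric_two
      (fun _ => by positivity) (fun _ => by positivity)).mul_left _
  rw [← hlim]
  refine (tendsto_tprod_one_add_of_dominated_convergence (f := fun t => g (r t)) hsum
    (fun p => ?_) ?_).congr' ?_
  · exact (((hr.pow _).const_mul _).sub ((hr.pow _).const_mul _)).mul
      ((((hr.pow _).const_mul _).const_sub 1).inv₀ (hne0 p))
  · filter_upwards [hr₁, hr₂] with t h₁ h₂ p
    have hnum : ‖x * q ^ p.1 * r t ^ p.2 - w * q ^ p.1 * r t ^ (p.2 + 1)‖ ≤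
        (‖x‖ + ‖w‖) * (‖q‖ ^ p.1 * (1 / 2 : ℝ) ^ p.2) := by
      calc _ = ‖x - w * r t‖ * (‖q‖ ^ p.1 * ‖r t‖ ^ p.2) := by
            rw [← norm_pow, ← norm_pow, ← norm_mul, ← norm_mul]; congr 1; ring
        _ ≤ _ := by
            gcongr
            refine (norm_sub_le _ _).trans ?_
            rw [norm_mul]
            gcongr
            exact mul_le_of_le_one_right (norm_nonneg _) (by linarith)
    calc ‖g (r t) p‖ ≤ (‖x‖ + ‖w‖) * (‖q‖ ^ p.1 * (1 / 2 : ℝ) ^ p.2) * max M 2 := by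
          rw [norm_mul]
          exact mul_le_mul hnum (hden h₁ h₂ p).2 (norm_nonneg _) (by positivity)
      _ = _ := by ring
  · filter_upwards [hr₁, hr₂] with t h₁ h₂
    exact tprod_congr fun p => one_add_g (hden h₁ h₂ p).1

lemma ellipticGamma_eq_tprod_nome (z τ σ : ℂ) :
    ellipticGamma z τ σ = ∏' p : ℕ × ℕ,
      (1 - cexp (2 * π * I * τ) / cexp (2 * π * I * z) * cexp (2 * π * I * τ) ^ p.1 *
        cexp (2 * π * I * σ) ^ (p.2 + 1)) /
      (1 - cexp (2 * π * I * z) * cexp (2 * π * I * τ) ^ p.1 * cexp (2 * π * I * σ) ^ p.2) := by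
  refine tprod_congr fun p => ?_
  simp only [← Complex.exp_nat_mul, ← Complex.exp_sub, ← Complex.exp_add]
  congr 3 <;> push_cast <;> ring

lemma norm_exp_two_pi_I_mul_lt_one_s10 {τ : ℂ} (hτ : 0 < τ.im) : ‖cexp (2 * π * I * τ)‖ < 1 := by
  rw [Complex.norm_exp, Real.exp_lt_one_iff]
  have : (2 * π * I * τ : ℂ).re = -(2 * π * τ.im) := by simp
  rw [this, neg_lt_zero]
  positivity

lemma tendsto_exp_two_pi_I_mul_I_mul_atTop :
    Tendsto (fun t : ℝ => cexp (2 * π * I * (I * t))) atTop (𝓝 0) := by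
  rw [tendsto_zero_iff_norm_tendsto_zero]
  have h (t : ℝ) : ‖cexp (2 * π * I * (I * t))‖ = Real.exp (-(2 * π * t)) := by
    rw [Complex.norm_exp]
    congr 1
    simp
  simp only [h]
  exact Real.tendsto_exp_neg_atTop_nhds_zero.comp
    (tendsto_id.const_mul_atTop (by positivity))

end TrigonometricLimit

/-- the trigonometric limit `Γ̄(z, τ, it) → Γ_trig(z, τ)` as `t → +∞`. -/
theorem ellipticGammaBar_tendsto_qGamma (z τ : ℂ) (hτ : 0 < τ.im)
    (hz : ∀ j : ℕ, Complex.exp (2 * Real.pi * Complex.I * τ * (z + (j : ℂ))) ≠ 1) :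
    Tendsto (fun t : ℝ => ellipticGammaBar z τ (Complex.I * (t : ℂ))) atTop
      (nhds (qGammaTrig z τ)) := by
  set q := cexp (2 * π * I * τ) with hq_def
  have hq : ‖q‖ < 1 := norm_exp_two_pi_I_mul_lt_one_s10 hτ
  have hr := tendsto_exp_two_pi_I_mul_I_mul_atTop
  have hx (j : ℕ) : cexp (2 * π * I * (z * τ)) * q ^ j ≠ 1 := by
    rw [hq_def, ← Complex.exp_nat_mul, ← Complex.exp_add]
    convert hz j using 2
    ring
  have hgamma := tprod_div_tendsto_qPoch_inv (q / cexp (2 * π * I * (z * τ))) hq hx hr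
  have hrr := qPoch_tendsto_one_sub hr hr
  have htheta := (qPoch_tendsto_one_sub hr (tendsto_const_nhds (x := q))).mul
    (qPoch_tendsto_one_sub hr (hr.div_const q))
  have hslit : (1 - q) * (1 - 0 / q) ∈ slitPlane := by
    simpa [mem_slitPlane_iff] using Or.inl ((Complex.re_le_norm q).trans_lt hq)
  have hmain := (((tendsto_const_nhds (x := qPoch q q)).div hrr (by simp)).mul
    (htheta.cpow (tendsto_const_nhds (x := 1 - z)) hslit)).mul hgamma
  convert hmain using 1
  · funext t
    rw [ellipticGammaBar, ellipticGamma_eq_tprod_nome, theta₀]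
    rfl
  · rw [qGammaTrig, show 2 * π * I * τ * z = 2 * π * I * (z * τ) by ring, ← hq_def]
    simp only [sub_zero, zero_div, div_one, mul_one]
    ring_nf
end

section
/- (Theta duplication formula.) For complex numbers z and τ with Im τ > 0, the Jacobi theta function satisfies θ₀(2z, τ) = θ₀(z, τ) · θ₀(z + 1/2, τ) · θ₀(z + τ/2, τ) · θ₀(z + (1+τ)/2, τ). -/
open Complex Real Filter

theorem multipliable_one_sub_mul_pow (x : ℂ) {q : ℂ} (hq : ‖q‖ < 1) :
    Multipliable fun j : ℕ ↦ 1 - x * q ^ j := by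
  have h : Summable fun j : ℕ ↦ ‖-(x * q ^ j)‖ := by
    simpa [norm_mul] using (summable_geometric_of_lt_one (norm_nonneg q) hq).mul_left ‖x‖
  simpa [sub_eq_add_neg] using multipliable_one_add_of_summable h

theorem qPoch_mul_qPoch_neg (x : ℂ) {q : ℂ} (hq : ‖q‖ < 1) :
    qPoch x q * qPoch (-x) q = qPoch (x ^ 2) (q ^ 2) := by
  unfold qPoch
  rw [← (multipliable_one_sub_mul_pow x hq).tprod_mul (multipliable_one_sub_mul_pow (-x) hq)]
  exact tprod_congr fun j ↦ by ring

theorem qPoch_sq_mul_qPoch_sq (x : ℂ) {p : ℂ} (hp : ‖p‖ < 1) :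
    qPoch x (p ^ 2) * qPoch (x * p) (p ^ 2) = qPoch x p := by
  have hp2 : ‖p ^ 2‖ < 1 := by
    rw [norm_pow]
    exact pow_lt_one₀ (norm_nonneg p) hp two_ne_zero
  have he : (fun j : ℕ ↦ 1 - x * (p ^ 2) ^ j) = fun j ↦ 1 - x * p ^ (2 * j) := by
    funext j
    rw [pow_mul]
  have ho : (fun j : ℕ ↦ 1 - x * p * (p ^ 2) ^ j) = fun j ↦ 1 - x * p ^ (2 * j + 1) := by
    funext j
    ring
  have me := multipliable_one_sub_mul_pow x hp2
  have mo := multipliable_one_sub_mul_pow (x * p) hp2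
  rw [he] at me
  rw [ho] at mo
  unfold qPoch
  rw [he, ho]
  exact tprod_even_mul_odd (f := fun j ↦ 1 - x * p ^ j) me mo

theorem qPoch_sq_sq (x : ℂ) {p : ℂ} (hp : ‖p‖ < 1) :
    qPoch (x ^ 2) (p ^ 2) = qPoch x (p ^ 2) * qPoch (-x) (p ^ 2) *
      (qPoch (x * p) (p ^ 2) * qPoch (-(x * p)) (p ^ 2)) := by
  rw [← qPoch_mul_qPoch_neg x hp, ← qPoch_sq_mul_qPoch_sq x hp, ← qPoch_sq_mul_qPoch_sq (-x) hp,
    neg_mul]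
  ring

/-- the theta duplication formula
`θ₀(2z,τ) = θ₀(z,τ) θ₀(z+1/2,τ) θ₀(z+τ/2,τ) θ₀(z+(1+τ)/2,τ)`. -/
theorem theta₀_duplication (z τ : ℂ) (hτ : 0 < τ.im) :
    theta₀ (2 * z) τ =
      theta₀ z τ * theta₀ (z + 1 / 2) τ * theta₀ (z + τ / 2) τ *
        theta₀ (z + (1 + τ) / 2) τ := by
  obtain ⟨x, hx⟩ : ∃ x, x = Complex.exp (2 * π * I * z) := ⟨_, rfl⟩
  obtain ⟨p, hp⟩ : ∃ p, p = Complex.exp (π * I * τ) := ⟨_, rfl⟩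
  have hx0 : x ≠ 0 := hx ▸ Complex.exp_ne_zero _
  have hp0 : p ≠ 0 := hp ▸ Complex.exp_ne_zero _
  have hp1 : ‖p‖ < 1 := by
    rw [hp, Complex.norm_exp, Real.exp_lt_one_iff]
    simpa using mul_pos Real.pi_pos hτ
  have hq : Complex.exp (2 * π * I * τ) = p ^ 2 := by
    rw [hp, ← Complex.exp_nat_mul]
    congr 1
    push_cast
    ring
  have hxx : Complex.exp (2 * π * I * (2 * z)) = x ^ 2 := by
    rw [hx, ← Complex.exp_nat_mul]
    congr 1
    push_cast
    ring
  have hx1 : Complex.exp (2 * π * I * (z + 1 / 2)) = -x := by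
    rw [show 2 * π * I * (z + 1 / 2) = 2 * π * I * z + π * I by ring, Complex.exp_add,
      Complex.exp_pi_mul_I, hx, mul_neg_one]
  have hx2 : Complex.exp (2 * π * I * (z + τ / 2)) = x * p := by
    rw [hx, hp, ← Complex.exp_add]
    ring_nf
  have hx3 : Complex.exp (2 * π * I * (z + (1 + τ) / 2)) = -(x * p) := by
    rw [show 2 * π * I * (z + (1 + τ) / 2) = 2 * π * I * z + π * I * τ + π * I by ring,
      Complex.exp_add, Complex.exp_add, Complex.exp_pi_mul_I, hx, hp, mul_neg_one]
  have h2 : p ^ 2 / (x * p) = p / x := by field_simp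
  have hy : p ^ 2 / x ^ 2 = (p / x) ^ 2 := (div_pow p x 2).symm
  have hy1 : p ^ 2 / x = p / x * p := by ring
  unfold theta₀
  rw [hq, hxx, hx1, hx2, hx3, ← hx, div_neg, div_neg, h2, hy, hy1, qPoch_sq_sq x hp1,
    qPoch_sq_sq (p / x) hp1]
  ring
end
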